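/- Let G be a finite group, let B be a non-splitting Rota–Baxter operator on G, and set R = Im(B) ∩ Im(B̃). If the set {r·k : r ∈ R, k ∈ ker(B)} equals Im(B̃), then G = Im(B)·ker(B) is an exact factorization, i.e. Im(B) ∩ ker(B) = {e} and every element of G is a product l·k with l ∈ Im(B), k ∈ ker(B). -/

import Mathlib

/-- A Rota–Baxter operator of weight 1 on a group. -/
def IsRotaBaxter {G : Type*} [Group G] (B : G → G) : Prop :=
  ∀ g h : G, B g * B h = B (g * B g * h * (B g)⁻¹)

/-- A splitting Rota–Baxter operator: comes from an exact factorization G = HL. -/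
def IsSplitting {G : Type*} [Group G] (B : G → G) : Prop :=
  ∃ H L : Subgroup G, H ⊓ L = ⊥ ∧ (∀ g : G, ∃ h ∈ H, ∃ l ∈ L, g = h * l) ∧
    (∀ h ∈ H, ∀ l ∈ L, B (h * l) = l⁻¹)

/-- The companion Rota–Baxter operator B̃(g) = g⁻¹ · B(g⁻¹). -/
def tilde {G : Type*} [Group G] (B : G → G) : G → G := fun g => g⁻¹ * B g⁻¹

namespace IsRotaBaxter

variable {G : Type*} [Group G] {B : G → G}

theorem map_one (hB : IsRotaBaxter B) : B 1 = 1 := by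
  simpa using hB 1 1

theorem map_circ_inv (hB : IsRotaBaxter B) (g : G) :
    B ((B g)⁻¹ * g⁻¹ * B g) = (B g)⁻¹ := by
  have h := hB g ((B g)⁻¹ * g⁻¹ * B g)
  rw [show g * B g * ((B g)⁻¹ * g⁻¹ * B g) * (B g)⁻¹ = 1 by group, hB.map_one] at h
  exact eq_inv_of_mul_eq_one_right h

theorem mul_mem_range (hB : IsRotaBaxter B) {x y : G} (hx : x ∈ Set.range B)
    (hy : y ∈ Set.range B) : x * y ∈ Set.range B := by
  obtain ⟨a, rfl⟩ := hx
  obtain ⟨b, rfl⟩ := hy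
  exact ⟨_, (hB a b).symm⟩

theorem inv_tilde_mem_range (hB : IsRotaBaxter B) (g : G) :
    (tilde B g)⁻¹ ∈ Set.range (tilde B) := by
  refine ⟨((B g⁻¹)⁻¹ * g⁻¹⁻¹ * B g⁻¹)⁻¹, ?_⟩
  simp only [tilde]
  rw [inv_inv ((B g⁻¹)⁻¹ * g⁻¹⁻¹ * B g⁻¹), hB.map_circ_inv]
  group

/-- The fibres of `B` are at least as large as its kernel. -/
theorem card_range_prod_ker_le [Finite G] (hB : IsRotaBaxter B) :
    Nat.card (Set.range B × {g : G | B g = 1}) ≤ Nat.card G := by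
  choose s hs using fun y : Set.range B => y.2
  let f : Set.range B × {g : G | B g = 1} → G :=
    fun p => s p.1 * p.1 * p.2 * (p.1 : G)⁻¹
  have hf (p) : B (f p) = p.1 := by
    have h := hB (s p.1) p.2
    rw [hs, show B p.2 = 1 from p.2.2, mul_one] at h
    exact h.symm
  refine Nat.card_le_card_of_injective f fun p q hpq => ?_
  have h₁ : p.1 = q.1 := Subtype.ext (by rw [← hf p, ← hf q, hpq])
  refine Prod.ext h₁ (Subtype.ext ?_)
  simpa [f, h₁] using hpq

end IsRotaBaxter

/-- For a non-splitting Rota–Baxter operator B on a finite group with R·ker(B) = Im(B̃),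
the factorization G = Im(B)·ker(B) is exact. -/
theorem stmt15 {G : Type*} [Group G] [Finite G] (B : G → G) (hB : IsRotaBaxter B)
    (hns : ¬ IsSplitting B)
    (h : {g : G | ∃ r ∈ Set.range B ∩ Set.range (tilde B), ∃ k, B k = 1 ∧ g = r * k}
      = Set.range (tilde B)) :
    (Set.range B ∩ {g : G | B g = 1} = {1}) ∧
    (∀ g : G, ∃ l ∈ Set.range B, ∃ k, B k = 1 ∧ g = l * k) := by
  have hfac : ∀ g : G, ∃ l ∈ Set.range B, ∃ k, B k = 1 ∧ g = l * k := by
    intro g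
    have hg := hB.inv_tilde_mem_range g
    rw [← h] at hg
    obtain ⟨r, hr, k, hk, hrk⟩ := hg
    refine ⟨B g⁻¹ * r, hB.mul_mem_range ⟨_, rfl⟩ hr.1, k, hk, ?_⟩
    rw [mul_assoc, ← hrk, tilde]
    group
  refine ⟨?_, hfac⟩
  let m : Set.range B × {g : G | B g = 1} → G := fun p => p.1 * p.2
  have hm : Function.Surjective m := fun g => by
    obtain ⟨l, hl, k, hk, rfl⟩ := hfac g
    exact ⟨(⟨l, hl⟩, ⟨k, hk⟩), rfl⟩
  have hinj := (hm.bijective_of_nat_card_le hB.card_range_prod_ker_le).injective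
  have h1 : (1 : G) ∈ Set.range B := ⟨1, hB.map_one⟩
  refine Set.eq_singleton_iff_unique_mem.2 ⟨⟨h1, hB.map_one⟩, fun x hx => ?_⟩
  have hxx := @hinj (⟨x, hx.1⟩, ⟨1, hB.map_one⟩) (⟨1, h1⟩, ⟨x, hx.2⟩) (by simp [m])
  exact congrArg (fun p => (p.1 : G)) hxx
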